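/- For every integer k ≥ 2 and every constant γ > 0 there exist B > 0 and n₀ ∈ ℕ such that for all n ≥ n₀ with k ∣ n the following holds. Let G be an (n,k,γ)-graph, let e ∈ E(G), and for each ℓ ∈ {1,…,k} let ℳ_ℓ denote the set of perfect matchings of G containing precisely ℓ edges that intersect e. Then for every ℓ ∈ {1,…,k−1}, |ℳ_ℓ| ≤ (B/n)·|ℳ_{ℓ+1}| and |ℳ_{ℓ+1}| ≤ B n·|ℳ_ℓ|. -/

import Mathlib

open scoped Classical

/-- The set of perfect matchings of the hypergraph on vertex set `Fin n` with edge set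
`E`: collections of pairwise disjoint edges covering every vertex. -/
noncomputable def perfectMatchings (n : ℕ) (E : Finset (Finset (Fin n))) :
    Finset (Finset (Finset (Fin n))) :=
  E.powerset.filter (fun M =>
    (M : Set (Finset (Fin n))).PairwiseDisjoint id ∧ M.biUnion id = Finset.univ)

/-- The set of perfect matchings of `E` containing precisely `l` edges intersecting the
edge `e`. -/
noncomputable def matchingsMeeting (n : ℕ) (E : Finset (Finset (Fin n)))
    (e : Finset (Fin n)) (l : ℕ) : Finset (Finset (Finset (Fin n))) :=
  (perfectMatchings n E).filter (fun M =>
    (M.filter (fun e' => (e ∩ e').Nonempty)).card = l)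

open Finset in
/-- A relation on a finite type in which every element is related to at least half of the
elements, on either side, contains the graph of a permutation. -/
theorem exists_perm_of_half_degree {ι : Type*} [Fintype ι] (R : ι → ι → Prop) [DecidableRel R]
    (hl : ∀ i, Fintype.card ι ≤ 2 * #{j | R i j})
    (hr : ∀ j, Fintype.card ι ≤ 2 * #{i | R i j}) :
    ∃ π : Equiv.Perm ι, ∀ i, R i (π i) := by
  have key := (Finset.all_card_le_biUnion_card_iff_exists_injective
    (fun i : ι => ({j | R i j} : Finset ι))).1 ?_
  · obtain ⟨f, hf, hR⟩ := key
    refine ⟨Equiv.ofBijective f (Finite.injective_iff_bijective.1 hf), fun i => ?_⟩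
    simpa using hR i
  intro s
  rcases s.eq_empty_or_nonempty with rfl | ⟨i, hi⟩
  · simp
  by_cases hs : 2 * #s ≤ Fintype.card ι
  · have h1 : #({j | R i j} : Finset ι) ≤ #(s.biUnion fun i => ({j | R i j} : Finset ι)) :=
      card_le_card (subset_biUnion_of_mem (fun i => ({j | R i j} : Finset ι)) hi)
    have := hl i
    omega
  · have : s.biUnion (fun i => ({j | R i j} : Finset ι)) = univ := by
      ext j
      simp only [mem_biUnion, mem_filter, mem_univ, true_and, iff_true]
      by_contra! hcon
      have hd : Disjoint s ({i | R i j} : Finset ι) := by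
        rw [Finset.disjoint_left]
        intro i hi hj
        exact hcon i hi (by simpa using hj)
      have h2 := card_union_of_disjoint hd
      have h3 := card_le_univ (s ∪ ({i | R i j} : Finset ι))
      have := hr j
      omega
    rw [this]
    exact card_le_univ s

open Finset in
/-- A Chernoff bound by counting: if for every `q` at most a `1/2 - δ` fraction of the `u` fail
`G q u`, then few `v : Fin B → Q` satisfy `G (v b) (v b')` for fewer than about half of the `b'`. -/
theorem card_few_successes_le {Q : Type*} [Fintype Q] {δ : ℝ} (hδ : 0 < δ) (hδ' : δ ≤ 1 / 2)
    {B : ℕ} (b : Fin B) (G : Q → Q → Prop)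
    (hG : ∀ q, (#{u | ¬ G q u} : ℝ) ≤ (1 / 2 - δ) * Fintype.card Q) :
    (#{v : Fin B → Q | 2 * #{b' | b' ≠ b ∧ G (v b) (v b')} < B + 2} : ℝ) * (1 - δ) ^ 2 ≤
      ((1 / 2 + δ) * (1 - δ) + (1 / 2 - δ) / (1 - δ)) ^ (B - 1) *
        (Fintype.card Q : ℝ) ^ B := by
  have hB : 0 < B := b.pos
  set z : ℝ := 1 - δ with hz
  have hz0 : 0 < z := by rw [hz]; linarith
  have hz1 : z ≤ 1 := by rw [hz]; linarith
  set q₀ : ℝ := (1 / 2 + δ) * z + (1 / 2 - δ) / z with hq₀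
  let ψ : Q → Q → ℝ := fun q u => if G q u then z else z⁻¹
  have hψ0 : ∀ q u, 0 < ψ q u := by
    intro q u; simp only [ψ]; split_ifs <;> positivity
  have hsum : ∀ q, ∑ u, ψ q u ≤ q₀ * Fintype.card Q := by
    intro q
    have h1 : ∑ u, ψ q u = #{u | G q u} * z + #{u | ¬ G q u} * z⁻¹ := by
      simp only [ψ]
      rw [Finset.sum_ite]; simp
    have h2 : (#{u | G q u} : ℝ) + #{u | ¬ G q u} = Fintype.card Q := by
      have := Finset.card_filter_add_card_filter_not (s := (univ : Finset Q)) (fun u => G q u)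
      rw [Finset.card_univ] at this
      exact_mod_cast this
    have h3 := hG q
    have h4 : z ≤ z⁻¹ := hz1.trans ((one_le_inv₀ hz0).2 hz1)
    rw [h1, hq₀, div_eq_mul_inv _ z, eq_sub_iff_add_eq.2 h2]
    generalize z⁻¹ = y at *
    nlinarith only [mul_nonneg (sub_nonneg.2 h3) (sub_nonneg.2 h4)]
  have hprod : ∀ v : Fin B → Q, 2 * #{b' | b' ≠ b ∧ G (v b) (v b')} < B + 2 →
      z ^ 2 ≤ ∏ b' : {j // j ≠ b}, ψ (v b) (v b') := by
    intro v hv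
    have h1 : ∏ b' : {j // j ≠ b}, ψ (v b) (v b')
        = z ^ #{b' : {j // j ≠ b} | G (v b) (v b')} *
          z⁻¹ ^ #{b' : {j // j ≠ b} | ¬ G (v b) (v b')} := by
      simp only [ψ]
      rw [Finset.prod_ite]; simp
    have h2 : #{b' : {j // j ≠ b} | G (v b) (v b')} = #{b' | b' ≠ b ∧ G (v b) (v b')} := by
      rw [← Fintype.card_subtype, ← Fintype.card_subtype]
      exact Fintype.card_congr (Equiv.subtypeSubtypeEquivSubtypeInter _ (fun j => G (v b) (v j)))
    have h3 := Finset.card_filter_add_card_filter_not (s := (univ : Finset {j // j ≠ b}))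
      (fun b' => G (v b) (v b'))
    have h4 : #(univ : Finset {j // j ≠ b}) = B - 1 := by
      rw [Finset.card_univ, Fintype.card_subtype_compl, Fintype.card_subtype_eq, Fintype.card_fin]
    rw [h1, inv_pow, ← div_eq_mul_inv, le_div_iff₀ (by positivity), ← pow_add]
    apply pow_le_pow_of_le_one hz0.le hz1
    omega
  calc (#{v : Fin B → Q | 2 * #{b' | b' ≠ b ∧ G (v b) (v b')} < B + 2} : ℝ) * z ^ 2
      = ∑ v : Fin B → Q with 2 * #{b' | b' ≠ b ∧ G (v b) (v b')} < B + 2, z ^ 2 := by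
        rw [sum_const, nsmul_eq_mul]
    _ ≤ ∑ v : Fin B → Q with 2 * #{b' | b' ≠ b ∧ G (v b) (v b')} < B + 2,
          ∏ b' : {j // j ≠ b}, ψ (v b) (v b') :=
        sum_le_sum fun v hv => hprod v (by simpa using hv)
    _ ≤ ∑ v : Fin B → Q, ∏ b' : {j // j ≠ b}, ψ (v b) (v b') :=
        sum_le_sum_of_subset_of_nonneg (filter_subset _ _)
          fun v _ _ => prod_nonneg fun _ _ => (hψ0 _ _).le
    _ = ∑ p : Q × ({j // j ≠ b} → Q), ∏ b', ψ p.1 (p.2 b') :=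
        Fintype.sum_equiv (Equiv.funSplitAt b Q) _ _ fun v => by simp [Equiv.funSplitAt]
    _ = ∑ q, (∑ u, ψ q u) ^ (B - 1) := by
        rw [Fintype.sum_prod_type]
        refine sum_congr rfl fun q _ => ?_
        have h := Finset.prod_univ_sum (fun _ : {j // j ≠ b} => (univ : Finset Q))
          (fun _ u => ψ q u)
        rw [Fintype.piFinset_univ] at h
        rw [← h, prod_const, Finset.card_univ, Fintype.card_subtype_compl,
          Fintype.card_subtype_eq, Fintype.card_fin]
    _ ≤ ∑ _q : Q, (q₀ * Fintype.card Q) ^ (B - 1) :=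
        sum_le_sum fun q _ => pow_le_pow_left₀ (sum_nonneg fun _ _ => (hψ0 _ _).le) (hsum q) _
    _ = q₀ ^ (B - 1) * (Fintype.card Q : ℝ) ^ B := by
        rw [sum_const, nsmul_eq_mul, Finset.card_univ, mul_pow]
        obtain ⟨m, rfl⟩ : ∃ m, B = m + 1 := ⟨B - 1, by omega⟩
        simp only [Nat.add_sub_cancel, pow_succ]
        ring

open Finset in
/-- Fibrewise counting along one coordinate of a finite product. -/
theorem card_mul_card_le_of_update {I α : Type*} [Fintype I] [DecidableEq I] [Fintype α] (i : I)
    (A : (I → α) → Prop) [DecidablePred A] {m : ℝ}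
    (h : ∀ v, (#{x | A (Function.update v i x)} : ℝ) ≤ m) :
    (#{v | A v} : ℝ) * Fintype.card α ≤ m * (Fintype.card α : ℝ) ^ Fintype.card I := by
  have h1 : ∀ p : α × ({j // j ≠ i} → α), ∀ x,
      Function.update ((Equiv.funSplitAt i α).symm p) i x =
        (Equiv.funSplitAt i α).symm (x, p.2) := by
    intro p x
    ext j
    by_cases hj : j = i
    · subst hj; simp [Equiv.funSplitAt]
    · simp [Equiv.funSplitAt, hj]
  have h2 : ∑ v : I → α, #{x | A (Function.update v i x)} = #{v | A v} * Fintype.card α := by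
    simp only [Finset.card_filter]
    rw [← (Equiv.funSplitAt i α).symm.sum_comp, ← (Equiv.funSplitAt i α).symm.sum_comp]
    simp only [h1]
    rw [Fintype.sum_prod_type, Fintype.sum_prod_type]
    change ∑ _ : α, (∑ y, ∑ x, if A ((Equiv.funSplitAt i α).symm (x, y)) then 1 else 0) = _
    rw [Finset.sum_const, Finset.card_univ, smul_eq_mul, mul_comm, sum_comm]
  have h3 : (#{v | A v} : ℝ) * Fintype.card α =
      ∑ v : I → α, (#{x | A (Function.update v i x)} : ℝ) := by
    exact_mod_cast h2.symm
  rw [h3]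
  refine (sum_le_sum fun v _ => h v).trans ?_
  simp [mul_comm]

/-- The set `A` is an edge of the `k`-graph `E`, unless it does not have exactly `k` elements. -/
def EdgeIfCard {V : Type*} (k : ℕ) (E : Finset (Finset V)) (A : Finset V) : Prop :=
  A.card = k → A ∈ E

open Finset in
/-- Exchanging the tips of disjoint sets `insert (Y i) (T i)` along a permutation. -/
theorem exists_exchange {V ι : Type*} [DecidableEq V] [Fintype ι] (T : ι → Finset V) (Y : ι → V)
    (hY : ∀ i, Y i ∉ T i)
    (hd : Pairwise fun i j => Disjoint (insert (Y i) (T i)) (insert (Y j) (T j)))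
    (π : Equiv.Perm ι) :
    (∀ i, Y (π i) ∉ T i) ∧
    ((univ.image fun i => insert (Y (π i)) (T i) : Finset (Finset V)) :
      Set (Finset V)).PairwiseDisjoint id ∧
    (univ.image fun i => insert (Y (π i)) (T i)).biUnion id =
      univ.biUnion (fun i => insert (Y i) (T i)) ∧
    ∀ e : Finset V, (∀ i, (e ∩ T i).Nonempty → Y (π i) ∉ e) →
      #{f ∈ univ.image fun i => insert (Y (π i)) (T i) | (e ∩ f).Nonempty} =
        #{i | (e ∩ T i).Nonempty} + #{i | Y i ∈ e} := by
  have hYT : ∀ i j, Y i ∉ T j := by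
    intro i j h
    by_cases hij : i = j
    · subst hij; exact hY i h
    · exact Finset.disjoint_left.1 (hd hij) (mem_insert_self _ _) (mem_insert_of_mem h)
  have hYY : Function.Injective Y := by
    intro i j h
    by_contra hij
    exact Finset.disjoint_left.1 (hd hij) (mem_insert_self _ _) (h ▸ mem_insert_self _ _)
  have hTT : ∀ i j, i ≠ j → Disjoint (T i) (T j) := fun i j h =>
    Finset.disjoint_of_subset_left (subset_insert _ _)
      (Finset.disjoint_of_subset_right (subset_insert _ _) (hd h))
  have hnew : ∀ i j, i ≠ j → Disjoint (insert (Y (π i)) (T i)) (insert (Y (π j)) (T j)) := by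
    intro i j h
    rw [disjoint_insert_left, disjoint_insert_right, mem_insert, not_or]
    exact ⟨⟨fun h' => h (π.injective (hYY h')), hYT _ _⟩, hYT _ _, hTT i j h⟩
  have hinj : Function.Injective fun i => insert (Y (π i)) (T i) := by
    intro i j h
    by_contra hij
    have := hnew i j hij
    simp only at h
    rw [h, disjoint_self] at this
    exact insert_ne_empty _ _ this
  refine ⟨fun i => hYT _ _, ?_, ?_, ?_⟩
  · intro a ha b hb hab
    simp only [coe_image, coe_univ, Set.image_univ, Set.mem_range] at ha hb
    obtain ⟨i, rfl⟩ := ha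
    obtain ⟨j, rfl⟩ := hb
    exact hnew i j fun h => hab (by rw [h])
  · ext x
    simp only [image_biUnion, mem_biUnion, mem_univ, true_and, id, mem_insert]
    constructor
    · rintro ⟨i, rfl | h⟩
      · exact ⟨_, Or.inl rfl⟩
      · exact ⟨_, Or.inr h⟩
    · rintro ⟨i, rfl | h⟩
      · exact ⟨π.symm i, Or.inl (by simp)⟩
      · exact ⟨_, Or.inr h⟩
  · intro e he
    rw [filter_image, card_image_of_injective _ hinj]
    have h1 : univ.filter (fun i => (e ∩ insert (Y (π i)) (T i)).Nonempty) =
        univ.filter (fun i => (e ∩ T i).Nonempty) ∪ univ.filter (fun i => Y (π i) ∈ e) := by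
      ext i
      simp only [mem_filter, mem_univ, true_and, mem_union, Finset.Nonempty, mem_inter, mem_insert]
      constructor
      · rintro ⟨x, hx, rfl | h⟩
        · exact Or.inr hx
        · exact Or.inl ⟨x, hx, h⟩
      · rintro (⟨x, hx, h⟩ | h)
        · exact ⟨x, hx, Or.inr h⟩
        · exact ⟨_, h, Or.inl rfl⟩
    have h2 : #({i | Y (π i) ∈ e} : Finset ι) = #({i | Y i ∈ e} : Finset ι) := by
      rw [← Fintype.card_subtype, ← Fintype.card_subtype]
      exact Fintype.card_congr (π.subtypeEquiv fun _ => Iff.rfl)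
    rw [h1, card_union_of_disjoint, h2]
    rw [Finset.disjoint_left]
    intro i hi hi'
    exact he i (by simpa using hi) (by simpa using hi')

open Finset in
/-- In a `k`-graph of codegree at least `(1/2 + γ) n`, few vertices extend a set of fewer than `k`
vertices to a `k`-set that is not an edge. -/
theorem card_nonextending_le {n k : ℕ} {γ : ℝ} (hγ : γ ≤ 1 / 2) (E : Finset (Finset (Fin n)))
    (hE : ∀ e ∈ E, #e = k)
    (hdeg : ∀ S : Finset (Fin n), #S = k - 1 → (1 / 2 + γ) * (n : ℝ) ≤ (#{e ∈ E | S ⊆ e} : ℝ))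
    (S : Finset (Fin n)) (hS : #S < k) :
    (#{y | ¬ EdgeIfCard k E (insert y S)} : ℝ) ≤ (1 / 2 - γ) * n := by
  by_cases hS' : #S = k - 1
  · have h1 : ({e ∈ E | S ⊆ e} : Finset (Finset (Fin n))) ⊆
        ({y | insert y S ∈ E} : Finset (Fin n)).image fun y => insert y S := by
      intro e he
      rw [mem_filter] at he
      have := hE e he.1
      obtain ⟨a, -, rfl⟩ := Finset.exists_eq_insert_iff.2 ⟨he.2, (by omega : #S + 1 = #e)⟩
      exact mem_image_of_mem _ (by simpa using he.1)
    have h2 := (card_le_card h1).trans card_image_le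
    have h3 : ({y | ¬ EdgeIfCard k E (insert y S)} : Finset (Fin n)) ⊆
        ({y | ¬ insert y S ∈ E} : Finset (Fin n)) := by
      intro y hy
      rw [mem_filter] at hy ⊢
      exact ⟨mem_univ _, fun h => hy.2 fun _ => h⟩
    have h4 := card_le_card h3
    have h5 := Finset.card_filter_add_card_filter_not (s := (univ : Finset (Fin n)))
      (fun y => insert y S ∈ E)
    rw [Finset.card_univ, Fintype.card_fin] at h5
    have h6 := hdeg S hS'
    have h2' : (#{e ∈ E | S ⊆ e} : ℝ) ≤ #{y | insert y S ∈ E} := by exact_mod_cast h2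
    have h4' : (#{y | ¬ EdgeIfCard k E (insert y S)} : ℝ) ≤ #{y | ¬ insert y S ∈ E} := by
      exact_mod_cast h4
    have h5' : (#{y | insert y S ∈ E} : ℝ) + #{y | ¬ insert y S ∈ E} = n := by exact_mod_cast h5
    linarith
  · rw [Finset.card_eq_zero.2]
    · have : (0 : ℝ) ≤ n := n.cast_nonneg
      simp only [CharP.cast_eq_zero]
      nlinarith
    · refine Finset.filter_eq_empty_iff.2 fun y _ h => h fun h' => ?_
      have := card_insert_le y S
      omega

open Finset in
/-- Each edge of a matching can be rotated uniformly: there are injections `ν i`, for `i : Fin k`,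
sending a covered vertex `x` to the successive vertices of the edge `g x` of the matching at `x`. -/
theorem exists_rotations {V : Type*} [DecidableEq V] {k : ℕ} [NeZero k] (N : Finset (Finset V))
    (hN : (N : Set (Finset V)).PairwiseDisjoint id) (hk : ∀ e ∈ N, #e = k) :
    ∃ (ν : Fin k → N.biUnion id → V) (g : N.biUnion id → Finset V), (∀ x, g x ∈ N) ∧
      (∀ x, (x : V) ∈ g x) ∧ (∀ x, (univ.image fun i => ν i x) = g x) ∧
      ∀ i, Function.Injective (ν i) := by
  have h1 : ∀ x : N.biUnion id, ∃ e : N, (x : V) ∈ (e : Finset V) := by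
    rintro ⟨x, hx⟩
    obtain ⟨e, he, hxe⟩ := mem_biUnion.1 hx
    exact ⟨⟨e, he⟩, hxe⟩
  choose g hg using h1
  have h2 : ∀ e : N, ∃ f : Fin k → V, Function.Injective f ∧ univ.image f = (e : Finset V) := by
    rintro ⟨e, he⟩
    refine ⟨fun i => ((e.equivFinOfCardEq (hk e he)).symm i : V),
      Subtype.val_injective.comp (Equiv.injective _), ?_⟩
    ext x
    simp only [mem_image, mem_univ, true_and]
    constructor
    · rintro ⟨i, rfl⟩
      exact Subtype.prop _
    · intro hx
      exact ⟨e.equivFinOfCardEq (hk e he) ⟨x, hx⟩, by simp⟩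
  choose en hinj hen using h2
  have hidx : ∀ x : N.biUnion id, ∃ i, en (g x) i = x := by
    intro x
    have := hg x
    rw [← hen (g x)] at this
    simpa using this
  choose idx hidx using hidx
  refine ⟨fun i x => en (g x) (i + idx x), fun x => g x, fun x => (g x).2, hg, fun x => ?_,
    fun i x y hxy => ?_⟩
  · refine Eq.trans ?_ (hen (g x))
    ext y
    simp only [mem_image, mem_univ, true_and]
    constructor
    · rintro ⟨i, rfl⟩
      exact ⟨_, rfl⟩
    · rintro ⟨i, rfl⟩
      exact ⟨i - idx x, by simp⟩
  · have hmem : ∀ (e : N) j, en e j ∈ (e : Finset V) := fun e j =>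
      (Finset.ext_iff.1 (hen e) _).1 (mem_image_of_mem _ (mem_univ j))
    have hgg : g x = g y := by
      by_contra hne
      refine Finset.disjoint_left.1 (hN (g x).2 (g y).2 fun h => hne (Subtype.ext h))
        (hmem (g x) (i + idx x)) ?_
      simp only at hxy
      rw [hxy]
      exact hmem _ _
    simp only at hxy
    rw [← hgg] at hxy
    have := add_left_cancel (hinj _ hxy)
    apply Subtype.ext
    rw [← hidx x, ← hidx y, ← hgg, this]

open Finset in
/-- The `r`-th transversal of the edges at `u`, without its tip `ν r (u 0)`. -/
noncomputable def stub {V α : Type*} [DecidableEq V] {k : ℕ} [NeZero k]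
    (ν : Fin k → α → V) (r : Fin k) (u : Fin k → α) : Finset V :=
  (univ.erase 0).image fun j => ν (j + r) (u j)

open Finset in
theorem insert_tip_stub {V α : Type*} [DecidableEq V] {k : ℕ} [NeZero k]
    (ν : Fin k → α → V) (r : Fin k) (u : Fin k → α) :
    insert (ν r (u 0)) (stub ν r u) = univ.image fun j => ν (j + r) (u j) := by
  have h : (univ : Finset (Fin k)) = insert 0 (univ.erase 0) := by simp
  rw [h, image_insert, zero_add, stub]

open Finset in
/-- If all degrees in the auxiliary graph of stubs and tips are at least about half, the prescribed
sets together with the edges of `N` at the vertices `v b j` can be covered by disjoint edges. -/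
theorem exists_rematching {n k B c : ℕ} [NeZero k] (hc : c ≤ 2) {α : Type*}
    (E N : Finset (Finset (Fin n))) (hE : ∀ e ∈ E, #e = k)
    (hN : (N : Set (Finset (Fin n))).PairwiseDisjoint id) (hNE : N ⊆ E)
    (ν : Fin k → α → Fin n) (g : α → Finset (Fin n)) (hg : ∀ x, g x ∈ N)
    (hν : ∀ x, (univ.image fun i => ν i x) = g x)
    (T : Fin c → Finset (Fin n)) (Y : Fin c → Fin n) (hT : ∀ w, #(T w) = k - 1)
    (hY : ∀ w, Y w ∉ T w)
    (hd : Pairwise fun w w' => Disjoint (insert (Y w) (T w)) (insert (Y w') (T w')))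
    (hTN : ∀ w, Disjoint (insert (Y w) (T w)) (N.biUnion id))
    (v : Fin B → Fin k → α) (hv : Function.Injective fun p : Fin B × Fin k => g (v p.1 p.2))
    (hl₁ : ∀ w r', ∃ b, B + 2 ≤ 2 * #{b' | b' ≠ b ∧
      EdgeIfCard k E (insert (ν r' (v b' 0)) (T w))})
    (hl₂ : ∀ b r r', B + 2 ≤ 2 * #{b' | b' ≠ b ∧
      EdgeIfCard k E (insert (ν r' (v b' 0)) (stub ν r (v b)))})
    (hr₁ : ∀ w r', ∃ b, B + 2 ≤ 2 * #{b' | b' ≠ b ∧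
      EdgeIfCard k E (insert (Y w) (stub ν r' (v b')))})
    (hr₂ : ∀ b r r', B + 2 ≤ 2 * #{b' | b' ≠ b ∧
      EdgeIfCard k E (insert (ν r (v b 0)) (stub ν r' (v b')))}) :
    ∃ O ⊆ N, #O = B * k ∧ (∀ b j, g (v b j) ∈ O) ∧ ∃ F ⊆ E,
      (F : Set (Finset (Fin n))).PairwiseDisjoint id ∧
      F.biUnion id = O.biUnion id ∪ univ.biUnion (fun w => insert (Y w) (T w)) ∧
      ∀ e : Finset (Fin n), Disjoint e (N.biUnion id) →
        #{f ∈ F | (e ∩ f).Nonempty} = #{w | (e ∩ T w).Nonempty} + #{w | Y w ∈ e} := by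
  have hk : 0 < k := Nat.pos_of_ne_zero (NeZero.ne k)
  have hmem : ∀ i x, ν i x ∈ g x := fun i x =>
    (Finset.ext_iff.1 (hν x) _).1 (mem_image_of_mem _ (mem_univ i))
  have hνinj : ∀ x, Function.Injective fun i => ν i x := by
    intro x
    rw [← Set.injOn_univ, ← coe_univ, ← Finset.card_image_iff, hν x, hE _ (hNE (hg x))]
    simp
  have hνv : ∀ b j i b' j' i', ν i (v b j) = ν i' (v b' j') → (b, j) = (b', j') ∧ i = i' := by
    intro b j i b' j' i' h
    have h1 : (b, j) = (b', j') := by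
      apply hv
      by_contra hne
      exact Finset.disjoint_left.1 (hN (hg _) (hg _) hne) (hmem i (v b j)) (h ▸ hmem i' (v b' j'))
    obtain ⟨rfl, rfl⟩ := Prod.mk.inj h1
    exact ⟨h1, hνinj _ h⟩
  have hcov : ∀ b j i, ν i (v b j) ∈ N.biUnion id := fun b j i =>
    mem_biUnion.2 ⟨_, hg _, hmem i _⟩
  let ι := Fin c ⊕ (Fin B × Fin k)
  let T' : ι → Finset (Fin n) := Sum.elim T fun p => stub ν p.2 (v p.1)
  let Y' : ι → Fin n := Sum.elim Y fun p => ν p.2 (v p.1 0)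
  have hmemI : ∀ (p : Fin B × Fin k) x, x ∈ insert (Y' (Sum.inr p)) (T' (Sum.inr p)) ↔
      ∃ j, ν (j + p.2) (v p.1 j) = x := by
    intro p x
    change x ∈ insert (ν p.2 (v p.1 0)) (stub ν p.2 (v p.1)) ↔ _
    rw [insert_tip_stub]
    simp
  have hstub : ∀ (p : Fin B × Fin k), #(stub ν p.2 (v p.1)) = k - 1 := by
    intro p
    rw [stub, card_image_of_injective, card_erase_of_mem (mem_univ _), Finset.card_univ,
      Fintype.card_fin]
    intro j j' h
    exact (Prod.mk.inj (hνv _ _ _ _ _ _ h).1).2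
  have hT' : ∀ i, #(T' i) = k - 1 := by
    rintro (w | p)
    · exact hT w
    · exact hstub p
  have hY' : ∀ i, Y' i ∉ T' i := by
    rintro (w | p)
    · exact hY w
    · change ν p.2 (v p.1 0) ∉ stub ν p.2 (v p.1)
      simp only [stub, mem_image, mem_erase, mem_univ, and_true, not_exists, not_and]
      intro j hj h
      exact hj (Prod.mk.inj (hνv _ _ _ _ _ _ h).1).2
  have hIN : ∀ p, insert (Y' (Sum.inr p)) (T' (Sum.inr p)) ⊆ N.biUnion id := by
    intro p x hx
    obtain ⟨j, rfl⟩ := (hmemI p x).1 hx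
    exact hcov _ _ _
  have hd' : Pairwise fun i j => Disjoint (insert (Y' i) (T' i)) (insert (Y' j) (T' j)) := by
    rintro (w | p) (w' | p') hne
    · exact hd fun h => hne (by rw [h])
    · exact disjoint_of_subset_right (hIN p') (hTN w)
    · exact disjoint_of_subset_left (hIN p) (hTN w').symm
    · rw [Finset.disjoint_left]
      intro x hx hx'
      obtain ⟨j, rfl⟩ := (hmemI p x).1 hx
      obtain ⟨j', h⟩ := (hmemI p' _).1 hx'
      obtain ⟨h1, h2⟩ := hνv _ _ _ _ _ _ h
      obtain ⟨h3, h4⟩ := Prod.mk.inj h1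
      rw [h4] at h2
      exact hne (by rw [Prod.ext h3.symm (add_left_cancel h2).symm])
  have hcard : ∀ A : Fin B → Fin k → Prop, (∀ r', B + 2 ≤ 2 * #{b' | A b' r'}) →
      ∀ S : Finset ι, (∀ b r, A b r → Sum.inr (b, r) ∈ S) → Fintype.card ι ≤ 2 * #S := by
    intro A hA S hS
    have h1 : #(univ.filter fun p : Fin B × Fin k => A p.1 p.2) ≤ #S := by
      apply card_le_card_of_injOn (fun p => Sum.inr p)
      · intro p hp
        exact hS _ _ (by simpa using hp)
      · intro p _ p' _ h
        exact Sum.inr_injective h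
    have h2 : #(univ.filter fun p : Fin B × Fin k => A p.1 p.2) =
        ∑ r', #(univ.filter fun b' => A b' r') := by
      simp only [Finset.card_filter]
      rw [Fintype.sum_prod_type_right]
    have h3 : k * (B + 2) ≤ 2 * ∑ r', #(univ.filter fun b' => A b' r') := by
      rw [mul_sum]
      calc k * (B + 2) = ∑ _r' : Fin k, (B + 2) := by simp
        _ ≤ _ := sum_le_sum fun r' _ => hA r'
    have h4 : Fintype.card ι = c + B * k := by simp [ι]
    rw [h4]
    nlinarith
  have hmono : ∀ (b : Fin B) (A : Fin B → Prop), B + 2 ≤ 2 * #{b' | b' ≠ b ∧ A b'} →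
      B + 2 ≤ 2 * #{b' | A b'} := by
    intro b A h
    have : #{b' | b' ≠ b ∧ A b'} ≤ #{b' | A b'} :=
      card_le_card (monotone_filter_right _ fun b' _ h => h.2)
    omega
  obtain ⟨π, hπ⟩ := exists_perm_of_half_degree
    (fun i i' : ι => EdgeIfCard k E (insert (Y' i') (T' i)) ∧
      ¬ (i.isLeft = true ∧ i'.isLeft = true)) (by
      rintro (w | p)
      · refine hcard (fun b' r' => EdgeIfCard k E (insert (ν r' (v b' 0)) (T w)))
          (fun r' => ?_) _ fun b r h => ?_
        · obtain ⟨b, hb⟩ := hl₁ w r'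
          exact hmono b _ hb
        · rw [mem_filter]
          exact ⟨mem_univ _, h, by simp⟩
      · refine hcard (fun b' r' => EdgeIfCard k E (insert (ν r' (v b' 0)) (stub ν p.2 (v p.1))))
          (fun r' => ?_) _ fun b r h => ?_
        · exact hmono p.1 _ (hl₂ _ _ _)
        · rw [mem_filter]
          exact ⟨mem_univ _, h, by simp⟩) (by
      rintro (w | p)
      · refine hcard (fun b' r' => EdgeIfCard k E (insert (Y w) (stub ν r' (v b'))))
          (fun r' => ?_) _ fun b r h => ?_
        · obtain ⟨b, hb⟩ := hr₁ w r'
          exact hmono b _ hb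
        · rw [mem_filter]
          exact ⟨mem_univ _, h, by simp⟩
      · refine hcard (fun b' r' => EdgeIfCard k E (insert (ν p.2 (v p.1 0)) (stub ν r' (v b'))))
          (fun r' => ?_) _ fun b r h => ?_
        · exact hmono p.1 _ (hr₂ _ _ _)
        · rw [mem_filter]
          exact ⟨mem_univ _, h, by simp⟩)
  obtain ⟨hπT, hF, hFU, hFe⟩ := exists_exchange T' Y' hY' hd' π
  refine ⟨univ.image fun p : Fin B × Fin k => g (v p.1 p.2), ?_, ?_, ?_,
    univ.image fun i => insert (Y' (π i)) (T' i), ?_, hF, ?_, ?_⟩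
  · intro e he
    obtain ⟨p, -, rfl⟩ := mem_image.1 he
    exact hg _
  · rw [card_image_of_injective _ hv]
    simp
  · intro b j
    exact mem_image.2 ⟨(b, j), mem_univ _, rfl⟩
  · intro e he
    obtain ⟨i, -, rfl⟩ := mem_image.1 he
    refine (hπ i).1 ?_
    rw [card_insert_of_notMem (hπT i), hT']
    omega
  · rw [hFU]
    ext x
    rw [mem_union, or_comm]
    simp only [mem_biUnion, mem_univ, true_and]
    constructor
    · rintro ⟨w | p, hx⟩
      · exact Or.inl ⟨w, hx⟩
      · obtain ⟨j, rfl⟩ := (hmemI p x).1 hx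
        exact Or.inr ⟨_, mem_image.2 ⟨(p.1, j), mem_univ _, rfl⟩, hmem _ _⟩
    · rintro (⟨w, hx⟩ | ⟨e, he, hx⟩)
      · exact ⟨Sum.inl w, hx⟩
      · obtain ⟨⟨b, j⟩, -, rfl⟩ := mem_image.1 he
        have hx' : x ∈ g (v b j) := hx
        rw [← hν] at hx'
        obtain ⟨i, -, rfl⟩ := mem_image.1 hx'
        refine ⟨Sum.inr (b, i - j), (hmemI _ _).2 ⟨j, ?_⟩⟩
        simp
  · intro e he
    have hT0 : ∀ p, ¬ (e ∩ T' (Sum.inr p)).Nonempty := by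
      rintro p ⟨x, hx⟩
      rw [mem_inter] at hx
      exact Finset.disjoint_left.1 he hx.1 (hIN p (mem_insert_of_mem hx.2))
    have hY0 : ∀ p, Y' (Sum.inr p) ∉ e := fun p hx =>
      Finset.disjoint_left.1 he hx (hIN p (mem_insert_self _ _))
    rw [hFe e ?_]
    · congr 1
      · simp only [Finset.card_filter]
        rw [Fintype.sum_sum_type]
        simp only [hT0, if_false, sum_const_zero, add_zero]
        rfl
      · simp only [Finset.card_filter]
        rw [Fintype.sum_sum_type]
        simp only [hY0, if_false, sum_const_zero, add_zero]
        rfl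
    · rintro (w | p) h1 h2
      · rcases hw : π (Sum.inl w) with w' | p'
        · exact (hπ (Sum.inl w)).2 ⟨rfl, by rw [hw]; rfl⟩
        · rw [hw] at h2
          exact hY0 _ h2
      · exact hT0 _ h1

open Finset in
theorem card_not_injective_mul_card_le {I α β : Type*} [Fintype I] [DecidableEq I] [Fintype α]
    [DecidableEq β] (g : α → β) {k : ℕ} (hg : ∀ y, #{x | g x = y} ≤ k) :
    (#{w : I → α | ¬ Function.Injective fun i => g (w i)} : ℝ) * Fintype.card α ≤
      (Fintype.card I) ^ 2 * k * (Fintype.card α : ℝ) ^ Fintype.card I := by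
  have h1 : ({w : I → α | ¬ Function.Injective fun i => g (w i)} : Finset (I → α)) ⊆
      ({p : I × I | p.1 ≠ p.2} : Finset (I × I)).biUnion
        fun p => {w : I → α | g (w p.1) = g (w p.2)} := by
    intro w hw
    rw [mem_filter, Function.Injective] at hw
    obtain ⟨-, hw⟩ := hw
    push Not at hw
    obtain ⟨i, j, h, hij⟩ := hw
    rw [mem_biUnion]
    exact ⟨(i, j), by simpa using hij, by simpa using h⟩
  have h2 : (#{w : I → α | ¬ Function.Injective fun i => g (w i)} : ℝ) ≤
      ∑ p : I × I with p.1 ≠ p.2, (#{w : I → α | g (w p.1) = g (w p.2)} : ℝ) := by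
    exact_mod_cast (card_le_card h1).trans card_biUnion_le
  have h3 : ∀ p ∈ ({p : I × I | p.1 ≠ p.2} : Finset (I × I)),
      (#{w : I → α | g (w p.1) = g (w p.2)} : ℝ) * Fintype.card α ≤
        k * (Fintype.card α : ℝ) ^ Fintype.card I := by
    intro p hp
    refine card_mul_card_le_of_update p.1 _ fun w => ?_
    have hp' : p.2 ≠ p.1 := fun h => (mem_filter.1 hp).2 h.symm
    simp only [Function.update_self, Function.update_of_ne hp']
    exact_mod_cast hg _
  calc _ ≤ (∑ p : I × I with p.1 ≠ p.2, (#{w : I → α | g (w p.1) = g (w p.2)} : ℝ)) *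
        Fintype.card α := by gcongr
    _ ≤ ∑ p : I × I with p.1 ≠ p.2, k * (Fintype.card α : ℝ) ^ Fintype.card I := by
        rw [sum_mul]
        exact sum_le_sum h3
    _ ≤ ∑ _p : I × I, k * (Fintype.card α : ℝ) ^ Fintype.card I :=
        sum_le_sum_of_subset_of_nonneg (filter_subset _ _) fun _ _ _ => by positivity
    _ = _ := by
        simp
        ring

open Finset in
/-- Choosing one coordinate at random, the resulting set is an edge with probability more than a
half. -/
theorem card_not_edgeIfCard_le {n k : ℕ} {γ : ℝ} (hγ0 : 0 < γ) (hγ : γ ≤ 1 / 2)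
    (E : Finset (Finset (Fin n)))
    (hE : ∀ e ∈ E, #e = k)
    (hdeg : ∀ S : Finset (Fin n), #S = k - 1 → (1 / 2 + γ) * (n : ℝ) ≤ (#{e ∈ E | S ⊆ e} : ℝ))
    {α : Type*} [Fintype α] [Nonempty α] (hα : n ≤ Fintype.card α + k * k)
    (hn : (k * k : ℝ) ≤ γ * n) (f : α → Fin n) (hf : Function.Injective f) (j : Fin k)
    (S : (Fin k → α) → Finset (Fin n)) (hS : ∀ u, #(S u) < k)
    (hSj : ∀ u x, S (Function.update u j x) = S u) :
    (#{u : Fin k → α | ¬ EdgeIfCard k E (insert (f (u j)) (S u))} : ℝ) ≤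
      (1 / 2 - γ / 2) * Fintype.card (Fin k → α) := by
  have h1 : ∀ u : Fin k → α, (#{x | ¬ EdgeIfCard k E
      (insert (f (Function.update u j x j)) (S (Function.update u j x)))} : ℝ) ≤
      (1 / 2 - γ / 2) * Fintype.card α := by
    intro u
    simp only [hSj, Function.update_self]
    have h2 : #{x | ¬ EdgeIfCard k E (insert (f x) (S u))} ≤
        #{y | ¬ EdgeIfCard k E (insert y (S u))} := by
      apply card_le_card_of_injOn f
      · intro x hx
        simpa using hx
      · exact hf.injOn
    have h2' : (#{x | ¬ EdgeIfCard k E (insert (f x) (S u))} : ℝ) ≤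
        #{y | ¬ EdgeIfCard k E (insert y (S u))} := by exact_mod_cast h2
    have h3 := card_nonextending_le hγ E hE hdeg (S u) (hS u)
    have h4 : (n : ℝ) ≤ Fintype.card α + k * k := by exact_mod_cast hα
    nlinarith
  have h2 := card_mul_card_le_of_update j
    (fun u => ¬ EdgeIfCard k E (insert (f (u j)) (S u))) h1
  have h3 : (0 : ℝ) < Fintype.card α := by exact_mod_cast Fintype.card_pos
  rw [mul_right_comm] at h2
  have h4 := le_of_mul_le_mul_right h2 h3
  simpa [Fintype.card_fun] using h4

open Finset in
theorem card_not_edgeIfCard_stub_le {n k : ℕ} [NeZero k] (hk : 2 ≤ k) {γ : ℝ} (hγ0 : 0 < γ)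
    (hγ : γ ≤ 1 / 2) (E : Finset (Finset (Fin n))) (hE : ∀ e ∈ E, #e = k)
    (hdeg : ∀ S : Finset (Fin n), #S = k - 1 → (1 / 2 + γ) * (n : ℝ) ≤ (#{e ∈ E | S ⊆ e} : ℝ))
    {α : Type*} [Fintype α] [Nonempty α] (hα : n ≤ Fintype.card α + k * k)
    (hn : (k * k : ℝ) ≤ γ * n) (ν : Fin k → α → Fin n) (hν : ∀ i, Function.Injective (ν i))
    (r : Fin k) (y : Fin n) :
    (#{u : Fin k → α | ¬ EdgeIfCard k E (insert y (stub ν r u))} : ℝ) ≤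
      (1 / 2 - γ / 2) * Fintype.card (Fin k → α) := by
  let j : Fin k := ⟨1, hk⟩
  have hj : j ∈ univ.erase (0 : Fin k) := by
    simp [j, Fin.ext_iff]
  have h1 : ∀ u : Fin k → α, insert y (stub ν r u) = insert (ν (j + r) (u j))
      (insert y (((univ.erase 0).erase j).image fun j => ν (j + r) (u j))) := by
    intro u
    rw [Finset.insert_comm, ← image_insert (fun j => ν (j + r) (u j)), insert_erase hj, stub]
  simp only [h1]
  refine card_not_edgeIfCard_le hγ0 hγ E hE hdeg hα hn (ν (j + r)) (hν _) j
    (fun u => insert y (((univ.erase 0).erase j).image fun j => ν (j + r) (u j))) ?_ ?_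
  · intro u
    have h2 := card_insert_le y (((univ.erase 0).erase j).image fun j => ν (j + r) (u j))
    have h3 := card_image_le (s := (univ.erase 0).erase j) (f := fun j => ν (j + r) (u j))
    rw [card_erase_of_mem hj, card_erase_of_mem (mem_univ _), Finset.card_univ,
      Fintype.card_fin] at h3
    omega
  · intro u x
    congr 1
    refine image_congr fun i hi => ?_
    have : i ≠ j := by
      have := mem_coe.1 hi
      exact (mem_erase.1 this).1
    simp only [Function.update_of_ne this]

/-- The number of blocks that makes the union bound work. -/
theorem exists_block_count (k : ℕ) {δ : ℝ} (hδ : 0 < δ) (hδ' : δ ≤ 1 / 4) :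
    ∃ B : ℕ, 0 < B ∧ (6 * k ^ 2 * B : ℝ) *
      (((1 / 2 + δ) * (1 - δ) + (1 / 2 - δ) / (1 - δ)) ^ (B - 1) / (1 - δ) ^ 2) ≤ 1 / 4 := by
  set q : ℝ := (1 / 2 + δ) * (1 - δ) + (1 / 2 - δ) / (1 - δ) with hq
  have hz : 0 < 1 - δ := by linarith
  have hq0 : 0 ≤ q := by
    rw [hq]
    have : 0 ≤ 1 / 2 - δ := by linarith
    positivity
  have hq1 : q < 1 := by
    rw [hq, ← sub_pos]
    have : 1 - ((1 / 2 + δ) * (1 - δ) + (1 / 2 - δ) / (1 - δ)) =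
        δ * (δ * (3 / 2 - δ)) / (1 - δ) := by
      field_simp
      ring
    rw [this]
    have : 0 < 3 / 2 - δ := by linarith
    positivity
  have h1 : Filter.Tendsto (fun m : ℕ => (6 * k ^ 2 / (1 - δ) ^ 2) * ((m : ℝ) * q ^ m + q ^ m))
      Filter.atTop (nhds ((6 * k ^ 2 / (1 - δ) ^ 2) * (0 + 0))) :=
    ((tendsto_self_mul_const_pow_of_lt_one hq0 hq1).add
      (tendsto_pow_atTop_nhds_zero_of_lt_one hq0 hq1)).const_mul _
  rw [add_zero, mul_zero] at h1
  obtain ⟨m, hm⟩ := (h1.eventually_le_const (by norm_num : (0 : ℝ) < 1 / 4)).exists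
  refine ⟨m + 1, Nat.succ_pos _, le_trans (le_of_eq ?_) hm⟩
  rw [Nat.add_sub_cancel]
  push_cast
  ring

open Finset in
/-- Among all choices of `B * k` covered vertices, at least half can be rematched: the edges of the
matching `N` at these vertices and the prescribed uncovered sets are covered by disjoint edges. -/
theorem card_rematchable_ge {n k B c : ℕ} [NeZero k] (hk : 2 ≤ k) (hB : 0 < B) (hc : c ≤ 2) {γ : ℝ}
    (hγ0 : 0 < γ) (hγ : γ ≤ 1 / 2)
    (hBq : (6 * k ^ 2 * B : ℝ) * (((1 / 2 + γ / 2) * (1 - γ / 2) +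
      (1 / 2 - γ / 2) / (1 - γ / 2)) ^ (B - 1) / (1 - γ / 2) ^ 2) ≤ 1 / 4)
    (hkn : (k * k : ℝ) ≤ γ * n) {α : Type*} [Fintype α] [Nonempty α]
    (hα : n ≤ Fintype.card α + k * k) (hα8 : 4 * ((B * k) ^ 2 * k) ≤ Fintype.card α)
    (E N : Finset (Finset (Fin n))) (hE : ∀ e ∈ E, #e = k)
    (hdeg : ∀ S : Finset (Fin n), #S = k - 1 → (1 / 2 + γ) * (n : ℝ) ≤ (#{e ∈ E | S ⊆ e} : ℝ))
    (hN : (N : Set (Finset (Fin n))).PairwiseDisjoint id) (hNE : N ⊆ E)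
    (ν : Fin k → α → Fin n) (hνi : ∀ i, Function.Injective (ν i)) (g : α → Finset (Fin n))
    (hg : ∀ x, g x ∈ N) (hgk : ∀ y, #{x | g x = y} ≤ k)
    (hν : ∀ x, (univ.image fun i => ν i x) = g x)
    (T : Fin c → Finset (Fin n)) (Y : Fin c → Fin n) (hT : ∀ w, #(T w) = k - 1)
    (hY : ∀ w, Y w ∉ T w)
    (hd : Pairwise fun w w' => Disjoint (insert (Y w) (T w)) (insert (Y w') (T w')))
    (hTN : ∀ w, Disjoint (insert (Y w) (T w)) (N.biUnion id)) :
    1 / 2 * (Fintype.card α : ℝ) ^ (B * k) ≤ (#{v : Fin B → Fin k → α |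
      ∃ O ⊆ N, #O = B * k ∧ (∀ b j, g (v b j) ∈ O) ∧ ∃ F ⊆ E,
        (F : Set (Finset (Fin n))).PairwiseDisjoint id ∧
        F.biUnion id = O.biUnion id ∪ univ.biUnion (fun w => insert (Y w) (T w)) ∧
        ∀ e : Finset (Fin n), Disjoint e (N.biUnion id) →
          #{f ∈ F | (e ∩ f).Nonempty} = #{w | (e ∩ T w).Nonempty} + #{w | Y w ∈ e}} : ℝ) := by
  set q : ℝ := (1 / 2 + γ / 2) * (1 - γ / 2) + (1 / 2 - γ / 2) / (1 - γ / 2) with hq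
  let Q := Fin k → α
  have hQ : (Fintype.card Q : ℝ) ^ B = (Fintype.card α : ℝ) ^ (B * k) := by
    rw [mul_comm, pow_mul, Fintype.card_fun, Fintype.card_fin]
    push_cast
    rfl
  have hQtot : (Fintype.card (Fin B → Q) : ℝ) = (Fintype.card α : ℝ) ^ (B * k) := by
    rw [← hQ, Fintype.card_fun, Fintype.card_fin]
    push_cast
    rfl
  let K := (Fin c ⊕ (Fin B × Fin k)) × Fin k × Bool
  let bK : K → Fin B := fun κ => κ.1.elim (fun _ => ⟨0, hB⟩) fun p => p.1
  let TK : K → Q → Finset (Fin n) := fun κ u => κ.1.elim T fun p => stub ν p.2 u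
  let YK : K → Q → Fin n := fun κ u => κ.1.elim Y fun p => ν p.2 (u 0)
  obtain ⟨G, hGt, hGf⟩ : ∃ G : K → Q → Q → Prop,
      (∀ i r q u, G (i, r, true) q u ↔
        EdgeIfCard k E (insert (ν r (u 0)) (TK (i, r, true) q))) ∧
      ∀ i r q u, G (i, r, false) q u ↔
        EdgeIfCard k E (insert (YK (i, r, false) q) (stub ν r u)) :=
    ⟨fun κ q u => bif κ.2.2 then EdgeIfCard k E (insert (ν κ.2.1 (u 0)) (TK κ q)) else
      EdgeIfCard k E (insert (YK κ q) (stub ν κ.2.1 u)),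
      fun _ _ _ _ => Iff.rfl, fun _ _ _ _ => Iff.rfl⟩
  have hTK : ∀ κ u, #(TK κ u) < k := by
    rintro ⟨w | p, r⟩ u
    · have := hT w
      change #(T w) < k
      omega
    · change #(stub ν p.2 u) < k
      refine lt_of_le_of_lt card_image_le ?_
      rw [card_erase_of_mem (mem_univ _), Finset.card_univ, Fintype.card_fin]
      omega
  have hG : ∀ κ q, (#{u | ¬ G κ q u} : ℝ) ≤ (1 / 2 - γ / 2) * Fintype.card Q := by
    rintro ⟨i, r, _ | _⟩ q
    · have := card_not_edgeIfCard_stub_le hk hγ0 hγ E hE hdeg hα hkn ν hνi r (YK ⟨i, r, false⟩ q)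
      simpa only [hGf] using this
    · have := card_not_edgeIfCard_le hγ0 hγ E hE hdeg hα hkn (ν r) (hνi r) 0
        (fun _ => TK ⟨i, r, true⟩ q) (fun _ => hTK _ _) (fun _ _ => rfl)
      simpa only [hGt] using this
  let bad : K → Finset (Fin B → Q) := fun κ =>
    {v | 2 * #{b' | b' ≠ bK κ ∧ G κ (v (bK κ)) (v b')} < B + 2}
  have hbad : ∀ κ, (#(bad κ) : ℝ) ≤
      q ^ (B - 1) / (1 - γ / 2) ^ 2 * (Fintype.card α : ℝ) ^ (B * k) := by
    intro κ
    have h := card_few_successes_le (δ := γ / 2) (by linarith) (by linarith) (bK κ) (G κ) (hG κ)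
    rw [hQ, ← hq] at h
    have hz : (0 : ℝ) < 1 - γ / 2 := by linarith
    rw [div_mul_eq_mul_div, le_div_iff₀ (by positivity)]
    exact h
  let coll : Finset (Fin B → Q) :=
    {v | ¬ Function.Injective fun p : Fin B × Fin k => g (v p.1 p.2)}
  have hcoll : (#coll : ℝ) ≤ 1 / 4 * (Fintype.card α : ℝ) ^ (B * k) := by
    have h1 : #coll = #{w : Fin B × Fin k → α | ¬ Function.Injective fun p => g (w p)} := by
      simp only [coll]
      rw [← Fintype.card_subtype, ← Fintype.card_subtype]
      exact Fintype.card_congr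
        ((Equiv.curry (Fin B) (Fin k) α).symm.subtypeEquiv fun v => Iff.rfl)
    have h2 := card_not_injective_mul_card_le (I := Fin B × Fin k) g hgk
    rw [← h1] at h2
    have h3 : Fintype.card (Fin B × Fin k) = B * k := by simp
    rw [h3] at h2
    have h4 : (4 : ℝ) * ((B * k : ℕ) ^ 2 * k) ≤ Fintype.card α := by exact_mod_cast hα8
    have h5 : (0 : ℝ) < Fintype.card α := by exact_mod_cast Fintype.card_pos
    have h6 : (0 : ℝ) ≤ (Fintype.card α : ℝ) ^ (B * k) := by positivity
    refine le_of_mul_le_mul_right (h2.trans ?_) h5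
    nlinarith
  let good : Finset (Fin B → Q) := univ.filter fun v =>
      ∃ O ⊆ N, #O = B * k ∧ (∀ b j, g (v b j) ∈ O) ∧ ∃ F ⊆ E,
        (F : Set (Finset (Fin n))).PairwiseDisjoint id ∧
        F.biUnion id = O.biUnion id ∪ univ.biUnion (fun w => insert (Y w) (T w)) ∧
        ∀ e : Finset (Fin n), Disjoint e (N.biUnion id) →
          #{f ∈ F | (e ∩ f).Nonempty} = #{w | (e ∩ T w).Nonempty} + #{w | Y w ∈ e}
  have hcover : (univ : Finset (Fin B → Q)) ⊆ good ∪ (coll ∪ univ.biUnion bad) := by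
    intro v _
    by_contra hv
    simp only [mem_union, not_or, mem_biUnion, mem_univ, true_and, not_exists] at hv
    obtain ⟨hv1, hv2, hv3⟩ := hv
    have hv2' : Function.Injective fun p : Fin B × Fin k => g (v p.1 p.2) := by
      by_contra h
      exact hv2 (mem_filter.2 ⟨mem_univ _, h⟩)
    have hv3' : ∀ κ, B + 2 ≤ 2 * #{b' | b' ≠ bK κ ∧ G κ (v (bK κ)) (v b')} := by
      intro κ
      by_contra h
      exact hv3 κ (mem_filter.2 ⟨mem_univ _, not_le.1 h⟩)
    refine hv1 (mem_filter.2 ⟨mem_univ _, ?_⟩)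
    refine exists_rematching hc E N hE hN hNE ν g hg hν T Y hT hY hd hTN
      v hv2' (fun w r' => ⟨⟨0, hB⟩, ?_⟩) (fun b r r' => ?_)
      (fun w r' => ⟨⟨0, hB⟩, ?_⟩) (fun b r r' => ?_)
    · simpa only [hGt, bK, TK, Sum.elim_inl] using hv3' ⟨Sum.inl w, r', true⟩
    · simpa only [hGt, bK, TK, Sum.elim_inr] using hv3' ⟨Sum.inr (b, r), r', true⟩
    · simpa only [hGf, bK, YK, Sum.elim_inl] using hv3' ⟨Sum.inl w, r', false⟩
    · simpa only [hGf, bK, YK, Sum.elim_inr] using hv3' ⟨Sum.inr (b, r), r', false⟩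
  change 1 / 2 * (Fintype.card α : ℝ) ^ (B * k) ≤ (#good : ℝ)
  have h1 := (card_le_card hcover).trans ((card_union_le _ _).trans
    (Nat.add_le_add_left ((card_union_le _ _).trans
      (Nat.add_le_add_left card_biUnion_le _)) _))
  rw [Finset.card_univ] at h1
  have h2 : (Fintype.card (Fin B → Q) : ℝ) ≤ #good + (#coll + ∑ κ, (#(bad κ) : ℝ)) := by
    exact_mod_cast h1
  have h3 : ∑ κ, (#(bad κ) : ℝ) ≤ 1 / 4 * (Fintype.card α : ℝ) ^ (B * k) := by
    have h4 : (Fintype.card K : ℝ) ≤ 6 * k ^ 2 * B := by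
      have : Fintype.card K ≤ 6 * k ^ 2 * B := by
        simp only [K, Fintype.card_prod, Fintype.card_sum, Fintype.card_fin, Fintype.card_bool]
        have : 1 ≤ B := hB
        have h5 : c ≤ 2 * B := by omega
        have h6 : c * (k * 2) ≤ 2 * B * (k * 2) := Nat.mul_le_mul_right _ h5
        have h7 : B * k * 2 ≤ B * k * k := Nat.mul_le_mul_left _ hk
        nlinarith
      exact_mod_cast this
    have hz : (0 : ℝ) < 1 - γ / 2 := by linarith
    have hq0 : 0 ≤ q := by
      rw [hq]
      have : 0 ≤ 1 / 2 - γ / 2 := by linarith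
      positivity
    calc ∑ κ, (#(bad κ) : ℝ)
        ≤ ∑ _κ : K, q ^ (B - 1) / (1 - γ / 2) ^ 2 * (Fintype.card α : ℝ) ^ (B * k) :=
          sum_le_sum fun κ _ => hbad κ
      _ = Fintype.card K * (q ^ (B - 1) / (1 - γ / 2) ^ 2) *
          (Fintype.card α : ℝ) ^ (B * k) := by
          rw [sum_const, nsmul_eq_mul, Finset.card_univ, mul_assoc]
      _ ≤ (6 * k ^ 2 * B) * (q ^ (B - 1) / (1 - γ / 2) ^ 2) *
          (Fintype.card α : ℝ) ^ (B * k) := by gcongr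
      _ ≤ 1 / 4 * (Fintype.card α : ℝ) ^ (B * k) := by gcongr
  rw [hQtot] at h2
  linarith

open Finset in
/-- For a constant proportion of the choices of a bounded number `B * k` of vertices, the edges of
the matching `N` at these vertices can be rematched together with the prescribed uncovered sets, in
such a way that stubs and tips of the prescribed sets are separated. -/
theorem exists_many_rematchings (k : ℕ) (hk : 2 ≤ k) {γ : ℝ} (hγ0 : 0 < γ) (hγ : γ ≤ 1 / 2) :
    ∃ B : ℕ, 0 < B ∧ ∃ n₀ : ℕ, ∀ n, n₀ ≤ n → ∀ E : Finset (Finset (Fin n)), (∀ e ∈ E, #e = k) →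
    (∀ S : Finset (Fin n), #S = k - 1 → (1 / 2 + γ) * (n : ℝ) ≤ (#{e ∈ E | S ⊆ e} : ℝ)) →
    ∀ N ⊆ E, (N : Set (Finset (Fin n))).PairwiseDisjoint id → n ≤ #(N.biUnion id) + k * k →
    ∀ c ≤ 2, ∀ (T : Fin c → Finset (Fin n)) (Y : Fin c → Fin n), (∀ w, #(T w) = k - 1) →
    (∀ w, Y w ∉ T w) →
    (Pairwise fun w w' => Disjoint (insert (Y w) (T w)) (insert (Y w') (T w'))) →
    (∀ w, Disjoint (insert (Y w) (T w)) (N.biUnion id)) →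
    1 / 2 * ((n : ℝ) / 2) ^ (B * k) ≤ (#{v : Fin B → Fin k → Fin n |
      ∃ O ⊆ N, #O = B * k ∧ (∀ b j, v b j ∈ O.biUnion id) ∧ ∃ F ⊆ E,
        (F : Set (Finset (Fin n))).PairwiseDisjoint id ∧
        F.biUnion id = O.biUnion id ∪ univ.biUnion (fun w => insert (Y w) (T w)) ∧
        ∀ e : Finset (Fin n), Disjoint e (N.biUnion id) →
          #{f ∈ F | (e ∩ f).Nonempty} = #{w | (e ∩ T w).Nonempty} + #{w | Y w ∈ e}} : ℝ) := by
  obtain ⟨B, hB, hBq⟩ := exists_block_count k (δ := γ / 2) (by linarith) (by linarith)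
  have : NeZero k := ⟨by omega⟩
  obtain ⟨n₁, hn₁⟩ := exists_nat_ge ((k * k : ℝ) / γ)
  refine ⟨B, hB, max (n₁ + 1) (max (2 * (k * k)) (8 * ((B * k) ^ 2 * k))), ?_⟩
  intro n hn E hE hdeg N hNE hN hcov c hc T Y hT hY hd hTN
  have hkn : (k * k : ℝ) ≤ γ * n := by
    rw [div_le_iff₀ hγ0] at hn₁
    have : (n₁ : ℝ) ≤ n := by exact_mod_cast (by omega : n₁ ≤ n)
    nlinarith
  obtain ⟨ν, g, hg, hxg, hν, hνi⟩ := exists_rotations (k := k) N hN fun e he => hE e (hNE he)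
  have hcard : Fintype.card (N.biUnion id) = #(N.biUnion id) := Fintype.card_coe _
  have hα2 : n ≤ 2 * #(N.biUnion id) := by omega
  have : Nonempty (N.biUnion id) := Fintype.card_pos_iff.1 (by omega)
  have hgk : ∀ y, #{x | g x = y} ≤ k := by
    intro y
    by_cases hy : y ∈ N
    · rw [← hE y (hNE hy)]
      apply card_le_card_of_injOn Subtype.val
      · intro x hx
        have : g x = y := by simpa using hx
        rw [← this]
        exact hxg x
      · exact Subtype.val_injective.injOn
    · rw [Finset.filter_eq_empty_iff.2]
      · simp
      · rintro x - rfl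
        exact hy (hg x)
  have h := card_rematchable_ge hk hB hc hγ0 hγ hBq hkn (hcard ▸ hcov) (by omega) E N hE hdeg hN
    hNE ν hνi g hg hgk hν T Y hT hY hd hTN
  rw [hcard] at h
  have hn2 : (n : ℝ) / 2 ≤ #(N.biUnion id) := by
    have : (n : ℝ) ≤ 2 * #(N.biUnion id) := by exact_mod_cast hα2
    linarith
  refine le_trans (by gcongr) (h.trans ?_)
  norm_cast
  apply card_le_card_of_injOn fun v b j => (v b j).val
  · intro v hv
    obtain ⟨O, hON, hO, hvO, hF⟩ := (mem_filter.1 hv).2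
    exact mem_filter.2 ⟨mem_univ _, O, hON, hO,
      fun b j => mem_biUnion.2 ⟨_, hvO b j, hxg _⟩, hF⟩
  · intro v _ v' _ h
    funext b j
    exact Subtype.ext (congrFun (congrFun h b) j)

open Finset in
theorem card_filter_inter_nonempty_le {V : Type*} [DecidableEq V] {M : Finset (Finset V)}
    (hM : (M : Set (Finset V)).PairwiseDisjoint id) (e : Finset V) :
    #{f ∈ M | (e ∩ f).Nonempty} ≤ #e := by
  have h : ((({f ∈ M | (e ∩ f).Nonempty} : Finset (Finset V)) : Set (Finset V))).PairwiseDisjoint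
      fun f => e ∩ f := by
    intro f hf f' hf' hne
    exact (hM (mem_filter.1 hf).1 (mem_filter.1 hf').1 hne).mono inter_subset_right
      inter_subset_right
  refine (card_le_card_biUnion h fun f hf => (mem_filter.1 hf).2).trans (card_le_card ?_)
  exact biUnion_subset.2 fun f _ => inter_subset_left

open Finset in
/-- Replacing the edges `O` of a perfect matching by disjoint edges `F` covering the same vertices
yields a perfect matching, and the replacement can be undone. -/
theorem switch_mem_matchingsMeeting {n k : ℕ} (hk : 0 < k) {E : Finset (Finset (Fin n))}
    (hE : ∀ f ∈ E, #f = k) {e : Finset (Fin n)} {l l' o d : ℕ} (hl : l' + o = l + d)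
    {M O F : Finset (Finset (Fin n))} (hM : M ∈ matchingsMeeting n E e l) (hO : O ⊆ M) (hF : F ⊆ E)
    (hFd : (F : Set (Finset (Fin n))).PairwiseDisjoint id) (hFO : F.biUnion id = O.biUnion id)
    (ho : #{f ∈ O | (e ∩ f).Nonempty} = o) (hd : #{f ∈ F | (e ∩ f).Nonempty} = d) :
    M \ O ∪ F ∈ matchingsMeeting n E e l' ∧ (M \ O ∪ F) \ F ∪ O = M ∧ #F = #O := by
  rw [matchingsMeeting, perfectMatchings, mem_filter, mem_filter, mem_powerset] at hM
  obtain ⟨⟨hME, hMd, hMu⟩, hMl⟩ := hM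
  have hcross : ∀ f ∈ M \ O, ∀ f' ∈ F, Disjoint f f' := by
    intro f hf f' hf'
    rw [mem_sdiff] at hf
    have h1 : f' ⊆ O.biUnion id := hFO ▸ subset_biUnion_of_mem id hf'
    refine Disjoint.mono_right h1 ((disjoint_biUnion_right _ _ _).2 fun g hg => ?_)
    exact hMd hf.1 (hO hg) fun h => hf.2 (h ▸ hg)
  have hdisj : Disjoint (M \ O) F := by
    rw [Finset.disjoint_left]
    intro f hf hf'
    have h1 := hE f (hF hf')
    have h2 := hcross f hf f hf'
    rw [disjoint_self, bot_eq_empty] at h2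
    rw [h2, card_empty] at h1
    omega
  have hdisj' : Disjoint (M \ O) O := sdiff_disjoint
  have hsub : M \ O ∪ O = M := sdiff_union_of_subset hO
  have hcov : ∀ A : Finset (Finset (Fin n)), A ⊆ E →
      (A : Set (Finset (Fin n))).PairwiseDisjoint id → #(A.biUnion id) = #A * k := by
    intro A hA hAd
    rw [card_biUnion hAd]
    exact sum_const_nat fun f hf => hE f (hA hf)
  refine ⟨?_, ?_, ?_⟩
  · rw [matchingsMeeting, perfectMatchings, mem_filter, mem_filter, mem_powerset]
    refine ⟨⟨union_subset (sdiff_subset.trans hME) hF, ?_, ?_⟩, ?_⟩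
    · rw [coe_union]
      refine Set.pairwiseDisjoint_union.2 ⟨hMd.subset (coe_subset.2 sdiff_subset), hFd, ?_⟩
      intro f hf f' hf' _
      exact hcross f hf f' hf'
    · rw [union_biUnion, hFO, ← union_biUnion, hsub, hMu]
    · rw [filter_union, card_union_of_disjoint (disjoint_filter_filter hdisj), hd]
      rw [← hsub, filter_union, card_union_of_disjoint (disjoint_filter_filter hdisj'), ho] at hMl
      omega
  · rw [union_sdiff_cancel_right hdisj, hsub]
  · have h1 := hcov F hF hFd
    rw [hFO, hcov O (hO.trans hME) (hMd.subset (coe_subset.2 hO))] at h1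
    exact (Nat.eq_of_mul_eq_mul_right hk h1).symm

/-- The vertices `v` lie on `K` edges of `M`, of which `o` meet `e`, that can be replaced by edges
of `E` of which `d` meet `e`. -/
def Switchable {n B k : ℕ} (E M : Finset (Finset (Fin n))) (e : Finset (Fin n)) (K o d : ℕ)
    (v : Fin B → Fin k → Fin n) : Prop :=
  ∃ O ⊆ M, ∃ F ⊆ E, (F : Set (Finset (Fin n))).PairwiseDisjoint id ∧
    F.biUnion id = O.biUnion id ∧ O.card = K ∧
    (O.filter fun f => (e ∩ f).Nonempty).card = o ∧
    (F.filter fun f => (e ∩ f).Nonempty).card = d ∧ ∀ b j, v b j ∈ O.biUnion id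

open Finset in
theorem card_subfamilies_le {n : ℕ} {M : Finset (Finset (Fin n))}
    (hM : (M : Set (Finset (Fin n))).PairwiseDisjoint id) (hne : ∀ f ∈ M, f.Nonempty)
    (e : Finset (Fin n)) (t : ℕ) :
    #{F ∈ M.powerset | #{f ∈ F | ¬ (e ∩ f).Nonempty} = t} ≤ 2 ^ #e * n ^ t := by
  have hMn : #M ≤ n := by
    have h := card_filter_inter_nonempty_le hM univ
    rw [filter_true_of_mem fun f hf => by simpa using hne f hf] at h
    simpa using h
  calc _ ≤ #(({f ∈ M | (e ∩ f).Nonempty}.powerset ×ˢ M.powersetCard t).image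
        fun p => p.1 ∪ p.2) := by
        apply card_le_card
        intro F hF
        rw [mem_filter, mem_powerset] at hF
        refine mem_image.2 ⟨({f ∈ F | (e ∩ f).Nonempty}, {f ∈ F | ¬ (e ∩ f).Nonempty}), ?_,
          filter_union_filter_not_eq _ _⟩
        rw [mem_product, mem_powerset, mem_powersetCard]
        exact ⟨filter_subset_filter _ hF.1, (filter_subset _ _).trans hF.1, hF.2⟩
    _ ≤ 2 ^ #{f ∈ M | (e ∩ f).Nonempty} * (#M).choose t := by
        refine card_image_le.trans ?_
        rw [card_product, card_powerset, card_powersetCard]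
    _ ≤ 2 ^ #e * n ^ t := by
        gcongr
        · norm_num
        · exact card_filter_inter_nonempty_le hM e
        · exact (Nat.choose_le_pow _ _).trans (Nat.pow_le_pow_left hMn t)

open Finset in
/-- Double counting of switchings between matchings meeting `e` in `l` and in `l'` edges. -/
theorem mul_card_matchingsMeeting_le {n k B t o d l l' : ℕ} (hk : 0 < k)
    {E : Finset (Finset (Fin n))} (hE : ∀ f ∈ E, #f = k) {e : Finset (Fin n)} (he : #e = k)
    (hl : l' + o = l + d) {β : ℝ}
    (hβ : ∀ M ∈ matchingsMeeting n E e l,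
      β ≤ #{v : Fin B → Fin k → Fin n | Switchable E M e (t + d) o d v}) :
    β * #(matchingsMeeting n E e l) ≤
      (2 ^ k * (2 ^ 2 ^ ((t + d) * k) * (((t + d) * k) ^ k) ^ B) : ℕ) * (n : ℝ) ^ t *
        #(matchingsMeeting n E e l') := by
  let S := (matchingsMeeting n E e l).sigma fun M =>
    ({v | Switchable E M e (t + d) o d v} : Finset (Fin B → Fin k → Fin n))
  let cand := fun M : Finset (Finset (Fin n)) =>
    {F ∈ {F ∈ M.powerset | #{f ∈ F | ¬ (e ∩ f).Nonempty} = t} | #F = t + d}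
  let D := fun F : Finset (Finset (Fin n)) => (F.biUnion id).powerset.powerset ×ˢ
    Fintype.piFinset fun _ : Fin B => Fintype.piFinset fun _ : Fin k => F.biUnion id
  let P := (matchingsMeeting n E e l').biUnion fun M => (cand M).biUnion fun F =>
    (D F).image fun p =>
      (⟨M \ F ∪ p.1, p.2⟩ : (_ : Finset (Finset (Fin n))) × (Fin B → Fin k → Fin n))
  have hSP : S ⊆ P := by
    rintro ⟨M, v⟩ hMv
    obtain ⟨hM, hv⟩ := mem_sigma.1 hMv
    obtain ⟨O, hO, F, hF, hFd, hFO, hOc, ho, hd, hvO⟩ := (mem_filter.1 hv).2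
    obtain ⟨h1, h2, h3⟩ := switch_mem_matchingsMeeting hk hE hl hM hO hF hFd hFO ho hd
    refine mem_biUnion.2 ⟨_, h1, mem_biUnion.2 ⟨F, ?_, mem_image.2 ⟨(O, v), ?_, ?_⟩⟩⟩
    · rw [mem_filter, mem_filter, mem_powerset]
      have h4 := card_filter_add_card_filter_not (s := F) (fun f => (e ∩ f).Nonempty)
      exact ⟨⟨subset_union_right, by omega⟩, by omega⟩
    · rw [mem_product, mem_powerset, Fintype.mem_piFinset]
      refine ⟨fun f hf => mem_powerset.2 ?_, fun b => Fintype.mem_piFinset.2 fun j => ?_⟩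
      · rw [hFO]
        exact subset_biUnion_of_mem id hf
      · rw [hFO]
        exact hvO b j
    · simp only [h2]
  have hP : #P ≤ #(matchingsMeeting n E e l') * (2 ^ k * n ^ t *
      (2 ^ 2 ^ ((t + d) * k) * (((t + d) * k) ^ k) ^ B)) := by
    refine card_biUnion_le_card_mul _ _ _ fun M hM => ?_
    rw [matchingsMeeting, perfectMatchings, mem_filter, mem_filter, mem_powerset] at hM
    obtain ⟨⟨hME, hMd, -⟩, -⟩ := hM
    have h1 : #(cand M) ≤ 2 ^ k * n ^ t := by
      rw [← he]
      exact (card_le_card (filter_subset _ _)).trans (card_subfamilies_le hMd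
        (fun f hf => card_pos.1 (by rw [hE f (hME hf)]; exact hk)) e t)
    refine (card_biUnion_le_card_mul _ _ _ fun F hF => ?_).trans (Nat.mul_le_mul_right _ h1)
    obtain ⟨hF, hFc⟩ := mem_filter.1 hF
    have hFM := mem_powerset.1 (mem_filter.1 hF).1
    have h2 : #(F.biUnion id) ≤ (t + d) * k := by
      rw [← hFc]
      exact card_biUnion_le_card_mul _ _ _ fun f hf => (hE f (hME (hFM hf))).le
    refine card_image_le.trans ?_
    rw [card_product, card_powerset, card_powerset, Fintype.card_piFinset_const,
      Fintype.card_piFinset_const]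
    gcongr <;> norm_num
  have hS : β * #(matchingsMeeting n E e l) ≤ #S := by
    rw [card_sigma, mul_comm, ← nsmul_eq_mul]
    push_cast
    exact card_nsmul_le_sum _ _ _ hβ
  have h : (#S : ℝ) ≤ (#(matchingsMeeting n E e l') * (2 ^ k * n ^ t *
      (2 ^ 2 ^ ((t + d) * k) * (((t + d) * k) ^ k) ^ B)) : ℕ) := by
    exact_mod_cast (card_le_card hSP).trans hP
  refine hS.trans (h.trans (le_of_eq ?_))
  push_cast
  ring

open Finset in
theorem disjoint_biUnion_of_disjoint_subfamilies {V : Type*} [DecidableEq V]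
    {M A A' : Finset (Finset V)}
    (hM : (M : Set (Finset V)).PairwiseDisjoint id) (hA : A ⊆ M) (hA' : A' ⊆ M)
    (h : Disjoint A A') : Disjoint (A.biUnion id) (A'.biUnion id) := by
  refine (disjoint_biUnion_left _ _ _).2 fun f hf =>
    (disjoint_biUnion_right _ _ _).2 fun f' hf' => ?_
  exact hM (hA hf) (hA' hf') fun hff => Finset.disjoint_left.1 h hf (hff ▸ hf')

open Finset in
/-- A prescribed local switching of the edges `R` meeting `e` into `P` and the sets
`insert (Y w) (T w)` can be completed to a switching in many ways. -/
theorem exists_many_switchable (k : ℕ) (hk : 2 ≤ k) {γ : ℝ} (hγ0 : 0 < γ) (hγ : γ ≤ 1 / 2) :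
    ∃ B : ℕ, 0 < B ∧ ∃ n₀ : ℕ, ∀ n, n₀ ≤ n → ∀ E : Finset (Finset (Fin n)), (∀ e ∈ E, #e = k) →
    (∀ S : Finset (Fin n), #S = k - 1 → (1 / 2 + γ) * (n : ℝ) ≤ (#{e ∈ E | S ⊆ e} : ℝ)) →
    ∀ M ∈ perfectMatchings n E, ∀ e : Finset (Fin n), #e = k →
    ∀ R ⊆ M, (∀ f ∈ R, (e ∩ f).Nonempty) → ∀ P ⊆ E,
    (P : Set (Finset (Fin n))).PairwiseDisjoint id →
    ∀ c ≤ 2, ∀ (T : Fin c → Finset (Fin n)) (Y : Fin c → Fin n), (∀ w, #(T w) = k - 1) →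
    (∀ w, Y w ∉ T w) →
    (Pairwise fun w w' => Disjoint (insert (Y w) (T w)) (insert (Y w') (T w'))) →
    Disjoint (univ.biUnion fun w => insert (Y w) (T w)) (P.biUnion id) →
    (univ.biUnion fun w => insert (Y w) (T w)) ∪ P.biUnion id = R.biUnion id →
    1 / 2 * ((n : ℝ) / 2) ^ (B * k) ≤ #{v : Fin B → Fin k → Fin n | Switchable E M e
      (B * k + #R) #R (#{w | (e ∩ T w).Nonempty} + #{w | Y w ∈ e} +
        #{f ∈ P | (e ∩ f).Nonempty}) v} := by
  obtain ⟨B, hB, n₀, h⟩ := exists_many_rematchings k hk hγ0 hγ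
  refine ⟨B, hB, n₀, ?_⟩
  intro n hn E hE hdeg M hM e he R hRM hR P hPE hPd c hc T Y hT hY hd hXP hXR
  rw [perfectMatchings, mem_filter, mem_powerset] at hM
  obtain ⟨hME, hMd, hMu⟩ := hM
  have hpos : ∀ f ∈ E, f.Nonempty := fun f hf => card_pos.1 (by rw [hE f hf]; omega)
  let N : Finset (Finset (Fin n)) := {f ∈ M | ¬ (e ∩ f).Nonempty}
  have hNM : N ⊆ M := filter_subset _ _
  have hNR : Disjoint N R := Finset.disjoint_left.2 fun f hf hf' => (mem_filter.1 hf).2 (hR f hf')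
  have hcov : n ≤ #(N.biUnion id) + k * k := by
    have h1 : univ = {f ∈ M | (e ∩ f).Nonempty}.biUnion id ∪ N.biUnion id := by
      rw [← union_biUnion, filter_union_filter_not_eq, hMu]
    have h2 : #({f ∈ M | (e ∩ f).Nonempty}.biUnion id) ≤ k * k :=
      (card_biUnion_le_card_mul _ _ _ fun f hf => (hE f (hME (mem_filter.1 hf).1)).le).trans
        (Nat.mul_le_mul_right _ (he ▸ card_filter_inter_nonempty_le hMd e))
    have h3 := card_union_le ({f ∈ M | (e ∩ f).Nonempty}.biUnion id) (N.biUnion id)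
    rw [← h1, Finset.card_univ, Fintype.card_fin] at h3
    omega
  have hNRd : Disjoint (N.biUnion id) (R.biUnion id) :=
    disjoint_biUnion_of_disjoint_subfamilies hMd hNM hRM hNR
  have heN : Disjoint e (N.biUnion id) := by
    refine (disjoint_biUnion_right _ _ _).2 fun f hf => ?_
    rw [disjoint_iff_inter_eq_empty, ← not_nonempty_iff_eq_empty]
    exact (mem_filter.1 hf).2
  refine (h n hn E hE hdeg N (hNM.trans hME) (hMd.subset (coe_subset.2 hNM)) hcov c hc T Y hT hY hd
    fun w => ?_).trans ?_
  · refine (hNRd.mono_right ?_).symm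
    rw [← hXR]
    exact (subset_biUnion_of_mem (fun w => insert (Y w) (T w)) (mem_univ w)).trans subset_union_left
  norm_cast
  refine card_le_card fun v hv => mem_filter.2 ⟨mem_univ _, ?_⟩
  obtain ⟨O, hON, hO, hvO, F, hF, hFd, hFO, hFe⟩ := (mem_filter.1 hv).2
  have hOR : Disjoint O R := hNR.mono_left hON
  have hFP : Disjoint (F.biUnion id) (P.biUnion id) := by
    rw [hFO, disjoint_union_left]
    refine ⟨(hNRd.mono_left (biUnion_subset_biUnion_of_subset_left _ hON)).mono_right ?_, hXP⟩
    rw [← hXR]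
    exact subset_union_right
  have hFP' : ∀ f ∈ F, ∀ f' ∈ P, Disjoint f f' := fun f hf f' hf' =>
    hFP.mono (subset_biUnion_of_mem id hf) (subset_biUnion_of_mem id hf')
  have hFP2 : Disjoint F P := by
    rw [Finset.disjoint_left]
    intro f hf hf'
    have := hFP' f hf f hf'
    rw [disjoint_self, bot_eq_empty] at this
    exact (hpos f (hF hf)).ne_empty this
  refine ⟨O ∪ R, union_subset (hON.trans hNM) hRM, F ∪ P, union_subset hF hPE,
    ?_, ?_, ?_, ?_, ?_, ?_⟩
  · rw [coe_union]
    exact Set.pairwiseDisjoint_union.2 ⟨hFd, hPd, fun f hf f' hf' _ => hFP' f hf f' hf'⟩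
  · rw [union_biUnion, hFO, union_biUnion, union_assoc, hXR]
  · rw [card_union_of_disjoint hOR, hO]
  · rw [filter_union, filter_eq_empty_iff.2 fun f hf => (mem_filter.1 (hON hf)).2, empty_union,
      filter_true_of_mem hR]
  · rw [filter_union, card_union_of_disjoint (disjoint_filter_filter hFP2), hFe e heN]
  · intro b j
    rw [union_biUnion]
    exact mem_union_left _ (hvO b j)

open Finset in
theorem exists_two_le_card_inter {n k l : ℕ} {E M : Finset (Finset (Fin n))} {e : Finset (Fin n)}
    (he : #e = k) (hl : l < k) (hM : M ∈ matchingsMeeting n E e l) :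
    ∃ f ∈ M, 2 ≤ #(e ∩ f) := by
  rw [matchingsMeeting, perfectMatchings, mem_filter, mem_filter] at hM
  obtain ⟨⟨-, -, hMu⟩, hMl⟩ := hM
  by_contra! h
  have h1 : e ⊆ {f ∈ M | (e ∩ f).Nonempty}.biUnion fun f => e ∩ f := by
    intro x hx
    have : x ∈ M.biUnion id := hMu ▸ mem_univ x
    obtain ⟨f, hf, hxf⟩ := mem_biUnion.1 this
    have hx' := mem_inter.2 ⟨hx, hxf⟩
    exact mem_biUnion.2 ⟨f, mem_filter.2 ⟨hf, ⟨x, hx'⟩⟩, hx'⟩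
  have h2 := (card_le_card h1).trans (card_biUnion_le_card_mul _ _ 1 fun f hf =>
    Nat.le_of_lt_succ (h f (mem_filter.1 hf).1))
  omega

open Finset in
/-- Two disjoint edges meeting the edge `e` can be switched locally so that afterwards exactly one
edge meets `e`. -/
theorem exists_merging {n k : ℕ} (hk : 0 < k) {E : Finset (Finset (Fin n))} (hE : ∀ f ∈ E, #f = k)
    {e : Finset (Fin n)} (he : e ∈ E) {f₁ f₂ : Finset (Fin n)} (h₁ : #f₁ = k) (h₂ : #f₂ = k)
    (h₁₂ : Disjoint f₁ f₂) (hf₁ : (e ∩ f₁).Nonempty) :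
    ∃ P ⊆ E, (P : Set (Finset (Fin n))).PairwiseDisjoint id ∧ ∃ c ≤ 2,
      ∃ (T : Fin c → Finset (Fin n)) (Y : Fin c → Fin n), (∀ w, #(T w) = k - 1) ∧
      (∀ w, Y w ∉ T w) ∧
      (Pairwise fun w w' => Disjoint (insert (Y w) (T w)) (insert (Y w') (T w'))) ∧
      Disjoint (univ.biUnion fun w => insert (Y w) (T w)) (P.biUnion id) ∧
      (univ.biUnion fun w => insert (Y w) (T w)) ∪ P.biUnion id = f₁ ∪ f₂ ∧
      #{w | (e ∩ T w).Nonempty} + #{w | Y w ∈ e} + #{f ∈ P | (e ∩ f).Nonempty} = 1 := by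
  have hU : #(f₁ ∪ f₂) = k + k := by rw [card_union_of_disjoint h₁₂, h₁, h₂]
  have split : ∀ X : Finset (Fin n), #X = k → ∃ y ∈ X, #(X.erase y) = k - 1 := by
    intro X hX
    obtain ⟨y, hy⟩ := card_pos.1 (hX ▸ hk)
    exact ⟨y, hy, by rw [card_erase_of_mem hy, hX]⟩
  rcases lt_or_ge #(e ∩ (f₁ ∪ f₂)) k with hs | hs
  · obtain ⟨A, heA, hAU, hA⟩ := exists_subsuperset_card_eq (n := k - 1)
      (inter_subset_right : e ∩ (f₁ ∪ f₂) ⊆ f₁ ∪ f₂) (by omega) (by omega)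
    obtain ⟨y, hy⟩ : ((f₁ ∪ f₂) \ A).Nonempty :=
      card_pos.1 (by rw [card_sdiff_of_subset hAU]; omega)
    obtain ⟨hyU, hyA⟩ := mem_sdiff.1 hy
    have hyAU : insert y A ⊆ f₁ ∪ f₂ := insert_subset hyU hAU
    have hX : #((f₁ ∪ f₂) \ insert y A) = k := by
      rw [card_sdiff_of_subset hyAU, card_insert_of_notMem hyA]
      omega
    obtain ⟨y', hy', hT'⟩ := split _ hX
    obtain ⟨hyU', hyA'⟩ := mem_sdiff.1 hy'
    have hout : ∀ x ∈ f₁ ∪ f₂, x ∉ A → x ∉ e := fun x hx hxA hxe =>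
      hxA (heA (mem_inter.2 ⟨hxe, hx⟩))
    have hd : Disjoint (insert y A) ((f₁ ∪ f₂) \ insert y A) := disjoint_sdiff
    have hT'e : e ∩ (((f₁ ∪ f₂) \ insert y A).erase y') = ∅ := by
      rw [← disjoint_iff_inter_eq_empty, Finset.disjoint_right]
      intro x hx
      obtain ⟨hx1, hx2⟩ := mem_sdiff.1 (mem_of_mem_erase hx)
      exact hout x hx1 fun h => hx2 (mem_insert_of_mem h)
    have hAe : (e ∩ A).Nonempty := by
      obtain ⟨x, hx⟩ := hf₁
      rw [mem_inter] at hx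
      exact ⟨x, mem_inter.2 ⟨hx.1, heA (mem_inter.2 ⟨hx.1, mem_union_left _ hx.2⟩)⟩⟩
    refine ⟨∅, empty_subset _, by simp, 2, le_rfl,
      ![A, ((f₁ ∪ f₂) \ insert y A).erase y'], ![y, y'], ?_, ?_, ?_, by simp, ?_, ?_⟩
    · simp [Fin.forall_fin_two, hA, hT']
    · simp [Fin.forall_fin_two, hyA]
    · intro w w' hne
      fin_cases w <;> fin_cases w'
      · exact absurd rfl hne
      · simpa [insert_erase hy'] using hd
      · simpa [insert_erase hy'] using hd.symm
      · exact absurd rfl hne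
    · have : (univ : Finset (Fin 2)) = {0, 1} := rfl
      simp only [this, biUnion_insert, singleton_biUnion, biUnion_empty, union_empty,
        Matrix.cons_val_zero, Matrix.cons_val_one, insert_erase hy', union_sdiff_of_subset hyAU]
    · have h1 : y ∉ e := hout y hyU hyA
      have h2 : y' ∉ e := hout y' hyU' fun h => hyA' (mem_insert_of_mem h)
      simp [Fin.univ_succ, filter_insert, filter_singleton, hAe, hT'e, h1, h2]
  · have heU : e ⊆ f₁ ∪ f₂ := by
      rw [← inter_eq_left]
      exact eq_of_subset_of_card_le inter_subset_left (by rw [hE e he]; exact hs)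
    have hX : #((f₁ ∪ f₂) \ e) = k := by
      rw [card_sdiff_of_subset heU, hE e he]
      omega
    obtain ⟨y, hy, hT⟩ := split _ hX
    have hTe : e ∩ (((f₁ ∪ f₂) \ e).erase y) = ∅ := by
      rw [← disjoint_iff_inter_eq_empty, Finset.disjoint_right]
      exact fun x hx => (mem_sdiff.1 (mem_of_mem_erase hx)).2
    have hee : e.Nonempty := hf₁.mono inter_subset_left
    refine ⟨{e}, singleton_subset_iff.2 he, by simp, 1, one_le_two,
      fun _ => ((f₁ ∪ f₂) \ e).erase y, fun _ => y, fun _ => hT, fun _ => notMem_erase _ _,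
      fun w w' h => absurd (Subsingleton.elim w w') h, ?_, ?_, ?_⟩
    · simpa [insert_erase hy] using (sdiff_disjoint : Disjoint ((f₁ ∪ f₂) \ e) e)
    · simp only [insert_erase hy, univ_unique, singleton_biUnion, id, sdiff_union_of_subset heU]
    · simp [hTe, (mem_sdiff.1 hy).2, hee, filter_singleton]

open Finset in
theorem card_matchingsMeeting_le_succ (k : ℕ) (hk : 2 ≤ k) {γ : ℝ} (hγ0 : 0 < γ)
    (hγ : γ ≤ 1 / 2) :
    ∃ C : ℝ, 0 < C ∧ ∃ n₀ : ℕ, ∀ n, n₀ ≤ n → ∀ E : Finset (Finset (Fin n)), (∀ e ∈ E, #e = k) →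
    (∀ S : Finset (Fin n), #S = k - 1 → (1 / 2 + γ) * (n : ℝ) ≤ (#{e ∈ E | S ⊆ e} : ℝ)) →
    ∀ e ∈ E, ∀ l, 1 ≤ l → l ≤ k - 1 →
      (#(matchingsMeeting n E e l) : ℝ) ≤ C / n * #(matchingsMeeting n E e (l + 1)) ∧
      (#(matchingsMeeting n E e (l + 1)) : ℝ) ≤ C * n * #(matchingsMeeting n E e l) := by
  obtain ⟨B, hB, n₀, h⟩ := exists_many_switchable k hk hγ0 hγ
  have ha : 0 < B * k := by positivity
  let D : ℕ → ℕ := fun K => 2 ^ k * (2 ^ 2 ^ (K * k) * ((K * k) ^ k) ^ B)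
  have hD : ∀ K, 0 < K → 0 < D K := fun K hK => by positivity
  let C : ℝ := max (D (B * k + 1)) (D (B * k + 2)) * (2 * 2 ^ (B * k))
  refine ⟨C, ?_, max n₀ 1, fun n hn E hE hdeg e he l hl hlk => ?_⟩
  · have := hD (B * k + 1) (by omega)
    positivity
  have hn0 : (0 : ℝ) < n := by exact_mod_cast (by omega : 0 < n)
  have hswitch := h n (by omega) E hE hdeg
  have hmM : ∀ {M l}, M ∈ matchingsMeeting n E e l → M ∈ perfectMatchings n E := fun hM =>
    (mem_filter.1 hM).1
  have hperf : ∀ {M}, M ∈ perfectMatchings n E →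
      M ⊆ E ∧ (M : Set (Finset (Fin n))).PairwiseDisjoint id := fun hM =>
    ⟨mem_powerset.1 (mem_filter.1 hM).1, (mem_filter.1 hM).2.1⟩
  have hup : ∀ M ∈ matchingsMeeting n E e l, 1 / 2 * ((n : ℝ) / 2) ^ (B * k) ≤
      #{v : Fin B → Fin k → Fin n | Switchable E M e (B * k - 1 + 2) 1 2 v} := by
    intro M hM
    obtain ⟨f, hf, hef⟩ := exists_two_le_card_inter (hE e he) (by omega) hM
    obtain ⟨y, hy⟩ : (e ∩ f).Nonempty := card_pos.1 (by omega)
    rw [mem_inter] at hy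
    have hT : (e ∩ f.erase y).Nonempty := by
      rw [← card_pos, inter_erase, card_erase_of_mem (mem_inter.2 hy)]
      omega
    have := hswitch M (hmM hM) e (hE e he) {f} (singleton_subset_iff.2 hf)
      (by simpa using ⟨y, mem_inter.2 hy⟩) ∅ (empty_subset _) (by simp) 1 one_le_two
      (fun _ => f.erase y) (fun _ => y)
      (fun _ => by rw [card_erase_of_mem hy.2, hE f ((hperf (hmM hM)).1 hf)])
      (fun _ => notMem_erase _ _) (fun w w' h => absurd (Subsingleton.elim w w') h) (by simp)
      (by simp [insert_erase hy.2])
    have hsub : B * k - 1 + 2 = B * k + 1 := by omega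
    simpa [hT, hy.1, hsub] using this
  have hdown : ∀ M ∈ matchingsMeeting n E e (l + 1), 1 / 2 * ((n : ℝ) / 2) ^ (B * k) ≤
      #{v : Fin B → Fin k → Fin n | Switchable E M e (B * k + 1 + 1) 2 1 v} := by
    intro M hM
    obtain ⟨hME, hMd⟩ := hperf (hmM hM)
    obtain ⟨f₁, hf₁, f₂, hf₂, hne⟩ := one_lt_card.1
      (show 1 < #{f ∈ M | (e ∩ f).Nonempty} by rw [(mem_filter.1 hM).2]; omega)
    rw [mem_filter] at hf₁ hf₂
    obtain ⟨P, hPE, hPd, c, hc, T, Y, hT, hY, hd, hXP, hX, hcount⟩ :=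
      exists_merging (by omega) hE he (hE f₁ (hME hf₁.1)) (hE f₂ (hME hf₂.1)) (hMd hf₁.1 hf₂.1 hne) hf₁.2
    have := hswitch M (hmM hM) e (hE e he) {f₁, f₂}
      (insert_subset hf₁.1 (singleton_subset_iff.2 hf₂.1)) (by simp [hf₁.2, hf₂.2]) P hPE hPd c hc
      T Y hT hY hd hXP (by simpa using hX)
    rwa [hcount, card_pair hne] at this
  have key : ∀ (K t p q : ℕ), D K ≤ max (D (B * k + 1)) (D (B * k + 2)) →
      1 / 2 * ((n : ℝ) / 2) ^ (B * k) * p ≤ D K * (n : ℝ) ^ t * q →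
      (n : ℝ) ^ (B * k) * p ≤ C * ((n : ℝ) ^ t * q) := by
    intro K t p q hK hpq
    rw [div_pow] at hpq
    have h1 : (D K : ℝ) ≤ max (D (B * k + 1)) (D (B * k + 2)) := by exact_mod_cast hK
    have h2 : (n : ℝ) ^ (B * k) * p =
        1 / 2 * ((n : ℝ) ^ (B * k) / 2 ^ (B * k)) * p * (2 * 2 ^ (B * k)) := by
      field_simp
    calc (n : ℝ) ^ (B * k) * p ≤ D K * (n : ℝ) ^ t * q * (2 * 2 ^ (B * k)) := by
          rw [h2]
          gcongr
      _ ≤ max (D (B * k + 1)) (D (B * k + 2)) * (n : ℝ) ^ t * q * (2 * 2 ^ (B * k)) := by gcongr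
      _ = _ := by
          simp only [C]
          ring
  have hsub : B * k - 1 + 2 = B * k + 1 := by omega
  have hpow : (n : ℝ) ^ (B * k) = n ^ (B * k - 1) * n := by
    rw [← pow_succ, Nat.sub_add_cancel ha]
  constructor
  · have h1 := key (B * k - 1 + 2) _ _ _ (hsub ▸ le_max_left _ _)
      (mul_card_matchingsMeeting_le (l' := l + 1) (by omega) hE (hE e he) (by omega) hup)
    rw [div_mul_eq_mul_div, le_div_iff₀ hn0]
    refine le_of_mul_le_mul_left ?_ (pow_pos hn0 (B * k - 1))
    rw [hpow] at h1
    linarith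
  · have h1 := key (B * k + 1 + 1) _ _ _ (le_max_right _ _)
      (mul_card_matchingsMeeting_le (l' := l) (by omega) hE (hE e he) (by omega) hdown)
    refine le_of_mul_le_mul_left ?_ (pow_pos hn0 (B * k))
    rw [pow_succ] at h1
    linarith

/-- Switching estimates: for an `(n,k,γ)`-graph `G`, an edge `e`, and
`ℳ_l` the set of perfect matchings of `G` with exactly `l` edges meeting `e`, one has
`|ℳ_l| ≤ (B/n)·|ℳ_{l+1}|` and `|ℳ_{l+1}| ≤ B·n·|ℳ_l|` for all `l ∈ {1,…,k−1}`. -/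
theorem stmt_6 :
    ∀ k : ℕ, 2 ≤ k → ∀ γ : ℝ, 0 < γ →
    ∃ B : ℝ, 0 < B ∧ ∃ n₀ : ℕ, ∀ n : ℕ, n₀ ≤ n → k ∣ n →
    ∀ E : Finset (Finset (Fin n)),
      (∀ e ∈ E, e.card = k) →
      (∀ S : Finset (Fin n), S.card = k - 1 →
        (1/2 + γ) * (n : ℝ) ≤ ((E.filter (fun e => S ⊆ e)).card : ℝ)) →
    ∀ e ∈ E, ∀ l : ℕ, 1 ≤ l → l ≤ k - 1 →
      ((matchingsMeeting n E e l).card : ℝ) ≤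
        (B / n) * ((matchingsMeeting n E e (l + 1)).card : ℝ) ∧
      ((matchingsMeeting n E e (l + 1)).card : ℝ) ≤
        B * (n : ℝ) * ((matchingsMeeting n E e l).card : ℝ) := by
  intro k hk γ hγ
  obtain ⟨C, hC, n₀, h⟩ := card_matchingsMeeting_le_succ k hk (γ := min γ (1 / 2))
    (lt_min hγ (by norm_num)) (min_le_right _ _)
  refine ⟨C, hC, n₀, fun n hn _ E hE hdeg => h n hn E hE fun S hS => le_trans ?_ (hdeg S hS)⟩
  gcongr
  exact min_le_left _ _
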